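/- Let n ≥ 3 and take V ≡ 1 on ℝⁿ. Then the auxiliary function ρ of V is the constant function ρ(x) = v_n^{−1/2}, where v_n is the Lebesgue measure of the unit ball of ℝⁿ. Moreover, for any 0 < γ < θ, the weight w(x) = (1+|x|)^{−(n+γ)} belongs to A_1^{ρ,θ}: there is a constant C > 0 such that M_V^θ w(x) ≤ C w(x) for almost every x ∈ ℝⁿ. -/

import Mathlib

open MeasureTheory Metric Filter Topology
open scoped ENNReal

noncomputable section

/-- Euclidean space `ℝⁿ`. -/
abbrev Eu (n : ℕ) := EuclideanSpace ℝ (Fin n)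

/-- Average of `f` over the ball `B(x,r)`. -/
def avgBall (n : ℕ) (f : Eu n → ℝ) (x : Eu n) (r : ℝ) : ℝ :=
  ((volume (ball x r)).toReal)⁻¹ * ∫ y in ball x r, f y

/-- `V` belongs to the reverse Hölder class `RH_q`: `V` is nonnegative, locally
integrable, and the `q`-averages over balls are controlled by the averages. -/
def IsReverseHolder (n : ℕ) (q : ℝ) (V : Eu n → ℝ) : Prop :=
  (∀ x, 0 ≤ V x) ∧ LocallyIntegrable V volume ∧
    ∃ C > (0:ℝ), ∀ (x : Eu n) (r : ℝ), 0 < r →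
      (avgBall n (fun y => V y ^ q) x r) ^ (1 / q) ≤ C * avgBall n V x r

/-- The auxiliary function `ρ` of `V`:
`ρ(x) = sup { r > 0 : r^{2-n} ∫_{B(x,r)} V ≤ 1 }`. -/
def auxRho (n : ℕ) (V : Eu n → ℝ) (x : Eu n) : ℝ :=
  sSup {r : ℝ | 0 < r ∧ (∫ y in ball x r, V y) / r ^ ((n : ℝ) - 2) ≤ 1}

/-- The weight class `A_p^{ρ,θ}` (for `1 < p < ∞`). -/
def MemApRho (n : ℕ) (p θ : ℝ) (ρ w : Eu n → ℝ) : Prop :=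
  (∀ x, 0 ≤ w x) ∧ LocallyIntegrable w volume ∧
    ∃ C > (0:ℝ), ∀ (x : Eu n) (r : ℝ), 0 < r →
      avgBall n w x r * (avgBall n (fun y => w y ^ (-(1 / (p - 1)))) x r) ^ (p - 1)
        ≤ C * (1 + r / ρ x) ^ (θ * p)

/-- The localized maximal operator `M_V^θ`. -/
def MVtheta (n : ℕ) (θ : ℝ) (ρ f : Eu n → ℝ) (x : Eu n) : ℝ :=
  ⨆ (x₀ : Eu n) (r : ℝ) (_ : 0 < r) (_ : x ∈ ball x₀ r),
    (1 + r / ρ x₀) ^ (-θ) * avgBall n (fun y => |f y|) x₀ r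

/-- The variant maximal operator `M_{V,η}` (with parameter `θ`). -/
def MVeta (n : ℕ) (θ η : ℝ) (ρ f : Eu n → ℝ) (x : Eu n) : ℝ :=
  ⨆ (x₀ : Eu n) (r : ℝ) (_ : 0 < r) (_ : x ∈ ball x₀ r),
    (1 + r / ρ x₀) ^ (-(θ * η)) * avgBall n (fun y => |f y|) x₀ r

/-- The class `A_1^{ρ,θ}`. -/
def MemA1Rho (n : ℕ) (θ : ℝ) (ρ w : Eu n → ℝ) : Prop :=
  (∀ x, 0 ≤ w x) ∧ LocallyIntegrable w volume ∧
    ∃ C > (0:ℝ), ∀ᵐ x ∂(volume : Measure (Eu n)), MVtheta n θ ρ w x ≤ C * w x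

/-- The weighted `L^p(w)` norm `(∫ |f|^p w)^{1/p}`, valued in `ℝ≥0∞`. -/
def wLpNorm (n : ℕ) (p : ℝ) (w f : Eu n → ℝ) : ℝ≥0∞ :=
  (∫⁻ x, ENNReal.ofReal (|f x| ^ p * w x)) ^ (1 / p)

/-- Membership in `L^p(w)`. -/
def MemWLp (n : ℕ) (p : ℝ) (w f : Eu n → ℝ) : Prop :=
  AEStronglyMeasurable f volume ∧ wLpNorm n p w f < ⊤

/-- Condition (1.6): `lim_{A→∞} A^{n-np} ∫_{|x|>1} w(Ax)|x|^{-np} dx = 0`. -/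
def Cond16 (n : ℕ) (p : ℝ) (w : Eu n → ℝ) : Prop :=
  Tendsto
    (fun A : ℝ =>
      A ^ ((n : ℝ) - n * p) * ∫ x in {x : Eu n | 1 < ‖x‖}, w (A • x) / ‖x‖ ^ ((n : ℝ) * p))
    atTop (nhds 0)

/-- The Muckenhoupt class `A_p`. -/
def MemMuckenhoupt (n : ℕ) (p : ℝ) (w : Eu n → ℝ) : Prop :=
  (∀ x, 0 ≤ w x) ∧ LocallyIntegrable w volume ∧
    ∃ C > (0:ℝ), ∀ (x : Eu n) (r : ℝ), 0 < r →
      avgBall n w x r * (avgBall n (fun y => w y ^ (-(1 / (p - 1)))) x r) ^ (p - 1) ≤ C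

/-- `C` is an admissible `BMO_θ(ρ)` bound for `f`. -/
def IsBmoBound (n : ℕ) (θ : ℝ) (ρ f : Eu n → ℝ) (C : ℝ) : Prop :=
  0 ≤ C ∧ ∀ (x : Eu n) (r : ℝ), 0 < r →
    avgBall n (fun y => |f y - avgBall n f x r|) x r ≤ C * (1 + r / ρ x) ^ θ

/-- `f ∈ BMO_θ(ρ)`. -/
def MemBMOTheta (n : ℕ) (θ : ℝ) (ρ f : Eu n → ℝ) : Prop :=
  LocallyIntegrable f volume ∧ ∃ C, IsBmoBound n θ ρ f C

/-- `b ∈ CMO_θ(ρ)`: `b` can be approximated in the `BMO_θ(ρ)` norm by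
`C_c^∞` functions. -/
def MemCMOTheta (n : ℕ) (θ : ℝ) (ρ b : Eu n → ℝ) : Prop :=
  LocallyIntegrable b volume ∧
    ∀ ε > (0:ℝ), ∃ g : Eu n → ℝ, ContDiff ℝ (⊤ : ℕ∞) g ∧ HasCompactSupport g ∧
      ∃ C < ε, IsBmoBound n θ ρ (fun x => b x - g x) C

/-- Kernel estimate (K1). -/
def K1 (n : ℕ) (ρ : Eu n → ℝ) (k : ℝ → Eu n → Eu n → ℝ) : Prop :=
  ∀ N > (0:ℝ), ∃ C > (0:ℝ), ∀ t > (0:ℝ), ∀ x y : Eu n,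
    0 < k t x y ∧
      k t x y ≤ C * t ^ (-(n : ℝ) / 2) * Real.exp (-(dist x y) ^ 2 / (5 * t)) *
        (1 + Real.sqrt t / ρ x + Real.sqrt t / ρ y) ^ (-N)

/-- Kernel Hölder estimate (K2) with exponent `δ`. -/
def K2 (n : ℕ) (ρ : Eu n → ℝ) (k : ℝ → Eu n → Eu n → ℝ) (δ : ℝ) : Prop :=
  ∃ c > (0:ℝ), ∀ N > (0:ℝ), ∃ C > (0:ℝ), ∀ t > (0:ℝ), ∀ x y h : Eu n, ‖h‖ ≤ Real.sqrt t →
    |k t (x + h) y - k t x y| ≤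
      C * (‖h‖ / Real.sqrt t) ^ δ * t ^ (-(n : ℝ) / 2) *
        Real.exp (-c * (dist x y) ^ 2 / t) *
        (1 + Real.sqrt t / ρ x + Real.sqrt t / ρ y) ^ (-N)

/-- The semigroup maximal function `T* f(x) = sup_{t>0} |∫ k_t(x,y) f(y) dy|`. -/
def Tstar (n : ℕ) (k : ℝ → Eu n → Eu n → ℝ) (f : Eu n → ℝ) (x : Eu n) : ℝ :=
  ⨆ (t : ℝ) (_ : 0 < t), |∫ y, k t x y * f y|

/-- The commutator maximal function
`T*_b f(x) = sup_{t>0} |∫ k_t(x,y)(b(x)-b(y)) f(y) dy|`. -/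
def TstarB (n : ℕ) (k : ℝ → Eu n → Eu n → ℝ) (b f : Eu n → ℝ) (x : Eu n) : ℝ :=
  ⨆ (t : ℝ) (_ : 0 < t), |∫ y, k t x y * (b x - b y) * f y|

/-- A smooth cutoff `φ` with `0 ≤ φ ≤ 1`, `φ ≡ 1` on `[0,1]`, `φ ≡ 0` on `[2,∞)`. -/
def IsCutoff (φ : ℝ → ℝ) : Prop :=
  ContDiff ℝ (⊤ : ℕ∞) φ ∧ (∀ s, 0 ≤ φ s ∧ φ s ≤ 1) ∧ (∀ s ≤ (1:ℝ), φ s = 1) ∧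
    ∀ s, (2:ℝ) ≤ s → φ s = 0

/-- The truncated kernel `k_{t,γ}(x,y) = k_t(x,y) (1 - φ(γ⁻¹ |x-y|))`. -/
def kGamma (n : ℕ) (φ : ℝ → ℝ) (γ : ℝ) (k : ℝ → Eu n → Eu n → ℝ) :
    ℝ → Eu n → Eu n → ℝ :=
  fun t x y => k t x y * (1 - φ (γ⁻¹ * dist x y))

theorem vol_ball_real (n : ℕ) [Nontrivial (Eu n)] (x : Eu n) {r : ℝ} (hr : 0 ≤ r) :
    (volume (ball x r)).toReal = r ^ n * (volume (ball (0 : Eu n) 1)).toReal := by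
  rw [Measure.addHaar_ball volume x hr, ENNReal.toReal_mul, ENNReal.toReal_ofReal (by positivity)]
  simp

theorem vol_unit_pos (n : ℕ) : 0 < (volume (ball (0 : Eu n) 1)).toReal :=
  ENNReal.toReal_pos (measure_ball_pos volume _ one_pos).ne' measure_ball_lt_top.ne

theorem auxRho_one (n : ℕ) [Nontrivial (Eu n)] (x : Eu n) :
    auxRho n (fun _ => 1) x = ((volume (ball (0 : Eu n) 1)).toReal) ^ (-(1/2) : ℝ) := by
  have hv := vol_unit_pos n
  unfold auxRho
  have hint : ∀ r : ℝ, 0 < r →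
      (∫ _ in ball x r, (1:ℝ)) = r ^ n * (volume (ball (0 : Eu n) 1)).toReal := by
    intro r hr
    rw [← vol_ball_real n x hr.le]
    simp [Measure.real]
  set v := (volume (ball (0 : Eu n) 1)).toReal with hvdef
  have hc : 0 < v ^ (-(1/2) : ℝ) := Real.rpow_pos_of_pos hv _
  have hc2 : (v ^ (-(1/2) : ℝ)) ^ 2 * v = 1 := by
    rw [← Real.rpow_natCast, ← Real.rpow_mul hv.le]
    norm_num
    rw [Real.rpow_neg_one]
    field_simp
  have : {r : ℝ | 0 < r ∧ (∫ y in ball x r, (1:ℝ)) / r ^ ((n : ℝ) - 2) ≤ 1}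
      = Set.Ioc 0 (v ^ (-(1/2) : ℝ)) := by
    ext r
    simp only [Set.mem_ofPred_eq, Set.mem_Ioc]
    refine and_congr_right fun hr => ?_
    rw [hint r hr, Real.rpow_sub hr, Real.rpow_natCast]
    have hrn : r ^ n ≠ 0 := by positivity
    have e : r ^ n * v / (r ^ n / r ^ (2:ℝ)) = r ^ 2 * v := by
      rw [Real.rpow_two]
      field_simp
    rw [e]
    have e2 : r ^ 2 * v ≤ 1 ↔ r ^ 2 ≤ (v ^ (-(1/2) : ℝ)) ^ 2 := by
      constructor <;> intro h
      · exact le_of_mul_le_mul_right (h.trans hc2.ge) hv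
      · exact (mul_le_mul_of_nonneg_right h hv.le).trans hc2.le
    exact e2.trans <| pow_le_pow_iff_left₀ hr.le hc.le two_ne_zero
  rw [this, csSup_Ioc hc]

theorem ball_estimate (n : ℕ) [Nontrivial (Eu n)] (θ γ c : ℝ) (hγ : 0 < γ) (hγθ : γ < θ) (hc : 0 < c) :
    ∃ C > (0:ℝ), ∀ (x x₀ : Eu n) (r : ℝ), 0 < r → x ∈ ball x₀ r →
      (1 + r / c) ^ (-θ) * avgBall n (fun y => |(1 + ‖y‖) ^ (-((n : ℝ) + γ))|) x₀ r ≤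
        C * (1 + ‖x‖) ^ (-((n : ℝ) + γ)) := by
  have hv := vol_unit_pos n
  have hvr : ∀ (x : Eu n) {r : ℝ}, 0 < r → _ := fun x r hr => vol_ball_real n x (r := r) hr.le
  set v := (volume (ball (0 : Eu n) 1)).toReal with hvdef
  set a : ℝ := (n : ℝ) + γ with ha
  have ha0 : 0 < a := by positivity
  have hI : Integrable (fun y : Eu n => (1 + ‖y‖) ^ (-a)) volume :=
    integrable_one_add_norm (by simp [ha, hγ])
  have hpos : ∀ y : Eu n, 0 ≤ (1 + ‖y‖) ^ (-a) := fun y => by positivity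
  set I := ∫ y : Eu n, (1 + ‖y‖) ^ (-a) with hIdef
  have hI0 : 0 ≤ I := integral_nonneg hpos
  refine ⟨(1/2:ℝ) ^ (-a) + I * v⁻¹ * c ^ γ * (1/4:ℝ) ^ (-a), by positivity, ?_⟩
  intro x x₀ r hr hx
  have habs : (fun y : Eu n => |(1 + ‖y‖) ^ (-a)|) = fun y => (1 + ‖y‖) ^ (-a) :=
    funext fun y => abs_of_nonneg (hpos y)
  rw [habs]
  unfold avgBall
  have hV : 0 < (volume (ball x₀ r)).toReal := by rw [hvr x₀ hr]; positivity
  have hint0 : 0 ≤ ∫ y in ball x₀ r, (1 + ‖y‖) ^ (-a) := integral_nonneg hpos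
  have hθ : 0 < θ := hγ.trans hγθ
  have hrc : 0 < r / c := by positivity
  rw [add_mul]
  rcases le_or_gt (4 * r) (1 + ‖x‖) with h | h
  · refine le_add_of_le_of_nonneg ?_ (by positivity)
    have h1 : (1 + r / c) ^ (-θ) ≤ 1 :=
      Real.rpow_le_one_of_one_le_of_nonpos (by linarith) (by linarith)
    have h2 : ∫ y in ball x₀ r, (1 + ‖y‖) ^ (-a) ≤
        (1/2:ℝ) ^ (-a) * (1 + ‖x‖) ^ (-a) * (volume (ball x₀ r)).toReal := by
      have : ∫ y in ball x₀ r, (1 + ‖y‖) ^ (-a) ≤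
          ∫ y in ball x₀ r, (1/2:ℝ) ^ (-a) * (1 + ‖x‖) ^ (-a) := by
        refine setIntegral_mono_on hI.integrableOn ?_ measurableSet_ball ?_
        · exact integrableOn_const measure_ball_lt_top.ne
        · intro y hy
          rw [← Real.mul_rpow (by norm_num) (by positivity)]
          refine Real.rpow_le_rpow_of_nonpos (by positivity) ?_ (by linarith)
          have d : dist x y < r + r := by
            have := dist_triangle_right x y x₀
            rw [mem_ball] at hx hy
            linarith
          have := norm_sub_norm_le x y
          rw [← dist_eq_norm] at this
          linarith
      refine this.trans (le_of_eq ?_)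
      simp [Measure.real]
      ring
    have h3 : ((volume (ball x₀ r)).toReal)⁻¹ * ∫ y in ball x₀ r, (1 + ‖y‖) ^ (-a) ≤
        (1/2:ℝ) ^ (-a) * (1 + ‖x‖) ^ (-a) := by
      rw [inv_mul_le_iff₀ hV, mul_comm]
      exact h2
    calc _ ≤ 1 * (((volume (ball x₀ r)).toReal)⁻¹ * ∫ y in ball x₀ r, (1 + ‖y‖) ^ (-a)) := by
          gcongr
      _ ≤ _ := by rw [one_mul]; exact h3
  · refine le_add_of_nonneg_of_le (by positivity) ?_
    have h1 : (1 + r / c) ^ (-θ) ≤ (r / c) ^ (-γ) :=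
      (Real.rpow_le_rpow_of_exponent_le (by linarith) (by linarith)).trans
        (Real.rpow_le_rpow_of_nonpos hrc (by linarith) (by linarith))
    have h2 : ∫ y in ball x₀ r, (1 + ‖y‖) ^ (-a) ≤ I :=
      setIntegral_le_integral hI (Eventually.of_forall hpos)
    have h4 : r ^ (-a) ≤ (1/4:ℝ) ^ (-a) * (1 + ‖x‖) ^ (-a) := by
      rw [← Real.mul_rpow (by norm_num) (by positivity)]
      exact Real.rpow_le_rpow_of_nonpos (by positivity) (by linarith) (by linarith)
    have h5 : (r / c) ^ (-γ) * ((r ^ n * v)⁻¹ * I) = I * v⁻¹ * c ^ γ * r ^ (-a) := by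
      rw [Real.div_rpow hr.le hc.le, Real.rpow_neg hc.le, ha, neg_add, Real.rpow_add hr,
        Real.rpow_neg hr.le (n:ℝ), Real.rpow_natCast, mul_inv, div_inv_eq_mul]
      ring
    rw [hvr x₀ hr]
    calc _ ≤ (r / c) ^ (-γ) * ((r ^ n * v)⁻¹ * I) := by gcongr
      _ = I * v⁻¹ * c ^ γ * r ^ (-a) := h5
      _ ≤ I * v⁻¹ * c ^ γ * ((1/4:ℝ) ^ (-a) * (1 + ‖x‖) ^ (-a)) := by gcongr
      _ = _ := by ring

/-- for `V ≡ 1`, `ρ ≡ v_n^{-1/2}` and, for `0 < γ < θ`,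
`w(x) = (1+|x|)^{-(n+γ)}` belongs to `A_1^{ρ,θ}`. -/
theorem constantPotential_A1 {n : ℕ} (hn : 3 ≤ n) (θ γ : ℝ) (hγ : 0 < γ) (hγθ : γ < θ) :
    (∀ x : Eu n,
      auxRho n (fun _ => 1) x = ((volume (ball (0 : Eu n) 1)).toReal) ^ (-(1/2) : ℝ)) ∧
    ∃ C > (0:ℝ), ∀ᵐ x ∂(volume : Measure (Eu n)),
      MVtheta n θ (auxRho n (fun _ => 1)) (fun y => (1 + ‖y‖) ^ (-((n : ℝ) + γ))) x ≤
        C * (1 + ‖x‖) ^ (-((n : ℝ) + γ)) := by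
  haveI : Nontrivial (Eu n) := by
    apply Module.nontrivial_of_finrank_pos (R := ℝ)
    rw [finrank_euclideanSpace_fin]
    omega
  refine ⟨auxRho_one n, ?_⟩
  obtain ⟨C, hC, h⟩ := ball_estimate n θ γ _ hγ hγθ
    (Real.rpow_pos_of_pos (vol_unit_pos n) (-(1/2) : ℝ))
  refine ⟨C, hC, Eventually.of_forall fun x => ?_⟩
  have hp : 0 ≤ C * (1 + ‖x‖) ^ (-((n : ℝ) + γ)) := by positivity
  unfold MVtheta
  refine Real.iSup_le (fun x₀ => Real.iSup_le (fun r => Real.iSup_le (fun hr =>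
    Real.iSup_le (fun hx => ?_) hp) hp) hp) hp
  rw [auxRho_one]
  exact h x x₀ r hr hx

end
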